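/- (Exchange Lemma I) Let d ≥ 2 and n = d+1. For any symmetrical code that satisfies node regeneration, and for any m ∈ [1:d−1], i ∈ [0:m−1], i' ∈ [0:i], and j ∈ [i'+1 : m−i+i'+1], one has ((d+1−j)/(d−m)) · H(U^{(i,m)} | M^{(m)}) + H(U^{(i',j)} | M^{(m)}) ≥ ((d+1−j)/(d−m)) · H(U^{(i,m+1)} | M^{(m)}) + H(U^{(i',j−1)} | M^{(m)}). -/

import Mathlib

open scoped BigOperators Classical

namespace MDCSR

noncomputable section

/-- `X` is a deterministic function of `Y`. -/
def IsFuncOf {Ω α β : Type*} (X : Ω → α) (Y : Ω → β) : Prop :=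
  ∃ f : β → α, ∀ ω, X ω = f (Y ω)

variable {Ω V : Type} [Fintype Ω]

/-- Probability of the event `X = x` under the probability mass function `p`. -/
def pm (p : Ω → ℝ) {α : Type*} (X : Ω → α) (x : α) : ℝ :=
  ∑ ω ∈ Finset.univ.filter (fun ω' => X ω' = x), p ω

/-- Shannon entropy of the random variable `X` under the probability mass function `p`. -/
def H (p : Ω → ℝ) {α : Type*} (X : Ω → α) : ℝ :=
  -∑ ω, p ω * Real.log (pm p X (X ω))

/-- An `(n = d+1, d)` code: messages `M 1, …, M d`, a key `K`, node contents
`W 1, …, W (d+1)`, and repair data `S i j` (data downloaded from node `i` to repair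
node `j`), all random variables on a common finite probability space `(Ω, p)`.
The messages are mutually independent, the key is independent of the messages,
each `W i` is a deterministic function of the messages and the key, and each
`S i j` is a deterministic function of `W i`. -/
structure Code (Ω V : Type) [Fintype Ω] (d : ℕ) : Type where
  p : Ω → ℝ
  p_nonneg : ∀ ω, 0 ≤ p ω
  p_sum : ∑ ω, p ω = 1
  M : ℕ → Ω → V
  K : Ω → V
  W : ℕ → Ω → V
  S : ℕ → ℕ → Ω → V
  M_indep : ∀ x : ℕ → V,
    pm p (fun ω (i : Fin d) => M (↑i + 1) ω) (fun i => x (↑i + 1)) =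
      ∏ i ∈ Finset.Icc 1 d, pm p (M i) (x i)
  K_indep : ∀ (k : V) (x : ℕ → V),
    pm p (fun ω => (K ω, fun (i : Fin d) => M (↑i + 1) ω)) (k, fun i => x (↑i + 1)) =
      pm p K k * pm p (fun ω (i : Fin d) => M (↑i + 1) ω) (fun i => x (↑i + 1))
  W_func : ∀ i ∈ Finset.Icc 1 (d + 1),
    IsFuncOf (W i) (fun ω => ((fun (j : Fin d) => M (↑j + 1) ω), K ω))
  S_func : ∀ i ∈ Finset.Icc 1 (d + 1), ∀ j ∈ Finset.Icc 1 (d + 1), i ≠ j →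
    IsFuncOf (S i j) (W i)

/-- Descriptors for the basic random variables of a code. -/
inductive Atom where
  | M : ℕ → Atom
  | K : Atom
  | W : ℕ → Atom
  | S : ℕ → ℕ → Atom

variable {d : ℕ}

/-- The random variable described by an atom. -/
def Code.atomRV (C : Code Ω V d) : Atom → Ω → V
  | .M i => C.M i
  | .K => C.K
  | .W i => C.W i
  | .S i j => C.S i j

/-- The joint random variable (tuple) described by a list of atoms. -/
def Code.rv (C : Code Ω V d) (L : List Atom) : Ω → List V :=
  fun ω => L.map fun a => C.atomRV a ω

/-- Joint entropy of a tuple of basic random variables. -/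
def Code.HL (C : Code Ω V d) (L : List Atom) : ℝ := H C.p (C.rv L)

/-- Conditional entropy `H(L₁ | L₂)`. -/
def Code.CH (C : Code Ω V d) (L₁ L₂ : List Atom) : ℝ := C.HL (L₁ ++ L₂) - C.HL L₂

/-- Mutual information `I(L₁ ; L₂)`. -/
def Code.MI (C : Code Ω V d) (L₁ L₂ : List Atom) : ℝ :=
  C.HL L₁ + C.HL L₂ - C.HL (L₁ ++ L₂)

/-- Relabeling of an atom along a permutation of the storage-node indices. -/
def Atom.perm (π : Equiv.Perm ℕ) : Atom → Atom
  | .M i => .M i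
  | .K => .K
  | .W i => .W (π i)
  | .S i j => .S (π i) (π j)

/-- A code is symmetrical if every joint entropy of a tuple of the basic random
variables is invariant under every permutation of the storage-node indices `[1:n]`. -/
def Code.Symmetrical (C : Code Ω V d) : Prop :=
  ∀ π : Equiv.Perm ℕ, (∀ i ∈ Finset.Icc 1 (d + 1), π i ∈ Finset.Icc 1 (d + 1)) →
    ∀ L : List Atom, C.HL (L.map (Atom.perm π)) = C.HL L

/-- The list `[a, a+1, …, b]`. -/
def icc (a b : ℕ) : List ℕ := List.range' a (b + 1 - a)

/-- `W_A` as a list of atoms. -/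
def Ws (A : List ℕ) : List Atom := A.map Atom.W

/-- `M_A` as a list of atoms. -/
def MsL (A : List ℕ) : List Atom := A.map Atom.M

/-- `M^{(m)} = (M_1, …, M_m)`. -/
def Mup (m : ℕ) : List Atom := MsL (icc 1 m)

/-- `S_{B → j}`. -/
def Sto (B : List ℕ) (j : ℕ) : List Atom := B.map fun i => Atom.S i j

/-- `S_{i → B}`. -/
def Sfrom (i : ℕ) (B : List ℕ) : List Atom := B.map fun j => Atom.S i j

/-- `S̄_{→ j} = S_{[j+1:n] → j}` (here `n = d+1`). -/
def SbarTo (d j : ℕ) : List Atom := Sto (icc (j + 1) (d + 1)) j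

/-- `S̄_{→ A}`. -/
def SbarToL (d : ℕ) (A : List ℕ) : List Atom := (A.map (SbarTo d)).flatten

/-- `S̲_{→ j} = S_{[1:j-1] → j}`. -/
def SunderTo (j : ℕ) : List Atom := Sto (icc 1 (j - 1)) j

/-- `S̲_{→ A}`. -/
def SunderToL (A : List ℕ) : List Atom := (A.map SunderTo).flatten

/-- `S_{→ j} = S_{([1:n] ∖ {j}) → j}` (here `n = d+1`). -/
def StoFull (d j : ℕ) : List Atom := Sto ((icc 1 (d + 1)).filter (fun i => i ≠ j)) j

/-- `(S_{→ j} : j ∈ A)`. -/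
def StoFullL (d : ℕ) (A : List ℕ) : List Atom := (A.map (StoFull d)).flatten

/-- `U^{(t,s)} = (W_{[1:t]}, S̄_{→[t+1:s]})`. -/
def U (d t s : ℕ) : List Atom := Ws (icc 1 t) ++ SbarToL d (icc (t + 1) s)

/-- Node regeneration: each `W j` is a deterministic function of `S_{→ j}`. -/
def Code.NodeRegen (C : Code Ω V d) : Prop :=
  ∀ j ∈ Finset.Icc 1 (d + 1), IsFuncOf (C.W j) (C.rv (StoFull d j))

/-- Message recovery for parameter `ℓ`: `M j` is constant for `j ∈ [1:ℓ]`, and for every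
`A ⊆ [1:n]` with `|A| ∈ [ℓ+1:d]`, `M_{|A|}` is a deterministic function of `W_A`. -/
def Code.MsgRecovery (C : Code Ω V d) (ℓ : ℕ) : Prop :=
  (∀ j ∈ Finset.Icc 1 ℓ, ∃ c : V, ∀ ω, C.M j ω = c) ∧
  ∀ A : Finset ℕ, A ⊆ Finset.Icc 1 (d + 1) → A.card ∈ Finset.Icc (ℓ + 1) d →
    IsFuncOf (C.M A.card) (C.rv (Ws (A.sort (· ≤ ·))))

/-- Repair secrecy for parameters `ℓ₁, ℓ₂`: for all disjoint `E₁, E₂ ⊆ [1:n]` with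
`|E₁| = ℓ₁`, `|E₂| = ℓ₂`, the messages `M_{ℓ+1}, …, M_d` are independent of
`((W_i : i ∈ E₁), (S_{→j} : j ∈ E₂))`, where `ℓ = ℓ₁ + ℓ₂`. -/
def Code.RepairSecrecy (C : Code Ω V d) (ℓ₁ ℓ₂ : ℕ) : Prop :=
  ∀ E₁ E₂ : Finset ℕ, E₁ ⊆ Finset.Icc 1 (d + 1) → E₂ ⊆ Finset.Icc 1 (d + 1) →
    Disjoint E₁ E₂ → E₁.card = ℓ₁ → E₂.card = ℓ₂ →
    C.MI (MsL (icc (ℓ₁ + ℓ₂ + 1) d))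
      (Ws (E₁.sort (· ≤ ·)) ++ StoFullL d (E₂.sort (· ≤ ·))) = 0

/-- `T_{d,k,ℓ} = Σ_{t=ℓ+1}^{k} (d+1−t)`, as a real number. -/
def T (d k ℓ : ℕ) : ℝ := ∑ t ∈ Finset.Icc (ℓ + 1) k, ((d : ℝ) + 1 - (t : ℝ))


/-! ### Submodularity of entropy on a finite probability space -/

lemma pm_eq_sum_ite (p : Ω → ℝ) {α : Type*} (X : Ω → α) (x : α) :
    pm p X x = ∑ ω, if X ω = x then p ω else 0 := by
  rw [pm, Finset.sum_filter]

lemma le_pm_apply {p : Ω → ℝ} (hp : ∀ ω, 0 ≤ p ω) {α : Type*} (X : Ω → α) (ω : Ω) :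
    p ω ≤ pm p X (X ω) :=
  Finset.single_le_sum (f := p) (fun i _ => hp i) (by simp)

/-- Entropy depends only on the partition of the sample space into level sets. -/
lemma H_congr (p : Ω → ℝ) {α β : Type*} {X : Ω → α} {Y : Ω → β}
    (h : ∀ ω ω', X ω = X ω' ↔ Y ω = Y ω') : H p X = H p Y := by
  have hpm : ∀ ω, pm p X (X ω) = pm p Y (Y ω) := fun ω => by
    simp only [pm, h]
  simp only [H, hpm]

/-- The conditional probabilities `p ω / P(X = x)` over the level set `X = x` sum to at most one.
-/
lemma sum_div_pm_le_one (p : Ω → ℝ) {α : Type*} (X : Ω → α) (x : α) :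
    ∑ ω, (if X ω = x then p ω / pm p X (X ω) else 0) ≤ 1 := by
  have : ∀ ω, (if X ω = x then p ω / pm p X (X ω) else 0)
      = (if X ω = x then p ω else 0) / pm p X x := fun ω => by
    split_ifs with h
    · rw [h]
    · simp
  simp only [this]
  rw [← Finset.sum_div, ← pm_eq_sum_ite]
  exact div_self_le_one _

lemma sum_mul_pm_div_le_one {p : Ω → ℝ} (hp : ∀ ω, 0 ≤ p ω) (hsum : ∑ ω, p ω = 1)
    {α β γ : Type*} (X : Ω → α) (Y : Ω → β) (Z : Ω → γ) :
    ∑ ω, p ω * (pm p (fun ω => (X ω, Z ω)) (X ω, Z ω) * pm p (fun ω => (Y ω, Z ω)) (Y ω, Z ω) /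
      (pm p (fun ω => (X ω, Y ω, Z ω)) (X ω, Y ω, Z ω) * pm p Z (Z ω))) ≤ 1 := by
  set T : Ω → α × β × γ := fun ω => (X ω, Y ω, Z ω) with hT
  have hterm : ∀ ω, p ω * (pm p (fun ω => (X ω, Z ω)) (X ω, Z ω) *
      pm p (fun ω => (Y ω, Z ω)) (Y ω, Z ω) / (pm p T (X ω, Y ω, Z ω) * pm p Z (Z ω)))
      = ∑ ω₁, ∑ ω₂, (if Z ω₂ = Z ω₁ then p ω₂ / pm p Z (Z ω₂) else 0) *
        (p ω₁ * (if T ω = (X ω₁, Y ω₂, Z ω₁) then p ω / pm p T (T ω) else 0)) := fun ω => by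
    rw [pm_eq_sum_ite p (fun ω => (X ω, Z ω)), pm_eq_sum_ite p (fun ω => (Y ω, Z ω)),
      Finset.sum_mul_sum, Finset.sum_div, Finset.mul_sum]
    refine Finset.sum_congr rfl fun ω₁ _ => ?_
    rw [Finset.sum_div, Finset.mul_sum]
    refine Finset.sum_congr rfl fun ω₂ _ => ?_
    by_cases hX : X ω₁ = X ω <;> by_cases hZ : Z ω₁ = Z ω <;> by_cases hY : Y ω₂ = Y ω <;>
      by_cases hZ' : Z ω₂ = Z ω <;>
      simp_all [Prod.ext_iff, eq_comm]
    ring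
  rw [Finset.sum_congr rfl fun ω _ => hterm ω, Finset.sum_comm]
  calc _ ≤ ∑ ω₁, p ω₁ := Finset.sum_le_sum fun ω₁ _ => ?_
    _ = 1 := hsum
  rw [Finset.sum_comm]
  have hT_le : ∀ x, ∑ ω, (if T ω = x then p ω / pm p T (T ω) else 0) ≤ 1 := fun x => by
    convert sum_div_pm_le_one p T x
  have hnn : ∀ ω₂, 0 ≤ if Z ω₂ = Z ω₁ then p ω₂ / pm p Z (Z ω₂) else 0 := fun ω₂ => by
    split_ifs
    · exact div_nonneg (hp _) ((hp _).trans (le_pm_apply hp Z ω₂))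
    · exact le_rfl
  calc _ ≤ ∑ ω₂, (if Z ω₂ = Z ω₁ then p ω₂ / pm p Z (Z ω₂) else 0) * p ω₁ :=
        Finset.sum_le_sum fun ω₂ _ => by
          rw [← Finset.mul_sum, ← Finset.mul_sum]
          exact mul_le_mul_of_nonneg_left
            (mul_le_of_le_one_right (hp _) (hT_le _)) (hnn ω₂)
    _ ≤ p ω₁ := by
        rw [← Finset.sum_mul]
        exact mul_le_of_le_one_left (hp _) (sum_div_pm_le_one p Z _)

/-- Submodularity of entropy: conditional mutual information is nonnegative. -/
lemma H_submodular {p : Ω → ℝ} (hp : ∀ ω, 0 ≤ p ω) (hsum : ∑ ω, p ω = 1)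
    {α β γ : Type*} (X : Ω → α) (Y : Ω → β) (Z : Ω → γ) :
    H p (fun ω => (X ω, Y ω, Z ω)) + H p Z
      ≤ H p (fun ω => (X ω, Z ω)) + H p (fun ω => (Y ω, Z ω)) := by
  have key := sum_mul_pm_div_le_one hp hsum X Y Z
  have hlog : ∀ ω, p ω * (Real.log (pm p (fun ω => (X ω, Z ω)) (X ω, Z ω))
        + Real.log (pm p (fun ω => (Y ω, Z ω)) (Y ω, Z ω))
        - Real.log (pm p (fun ω => (X ω, Y ω, Z ω)) (X ω, Y ω, Z ω)) - Real.log (pm p Z (Z ω)))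
      ≤ p ω * (pm p (fun ω => (X ω, Z ω)) (X ω, Z ω) * pm p (fun ω => (Y ω, Z ω)) (Y ω, Z ω) /
      (pm p (fun ω => (X ω, Y ω, Z ω)) (X ω, Y ω, Z ω) * pm p Z (Z ω))) - p ω := fun ω => by
    rcases (hp ω).eq_or_lt with h0 | hpos
    · simp [← h0]
    have h₁ := hpos.trans_le (le_pm_apply hp (fun ω => (X ω, Z ω)) ω)
    have h₂ := hpos.trans_le (le_pm_apply hp (fun ω => (Y ω, Z ω)) ω)
    have h₃ := hpos.trans_le (le_pm_apply hp (fun ω => (X ω, Y ω, Z ω)) ω)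
    have h₄ := hpos.trans_le (le_pm_apply hp Z ω)
    have hle := Real.log_le_sub_one_of_pos (div_pos (mul_pos h₁ h₂) (mul_pos h₃ h₄))
    rw [Real.log_div (mul_pos h₁ h₂).ne' (mul_pos h₃ h₄).ne', Real.log_mul h₁.ne' h₂.ne',
      Real.log_mul h₃.ne' h₄.ne'] at hle
    have := mul_le_mul_of_nonneg_left hle hpos.le
    linarith
  have htot := Finset.sum_le_sum fun ω (_ : ω ∈ Finset.univ) => hlog ω
  simp only [mul_sub, mul_add, Finset.sum_sub_distrib, Finset.sum_add_distrib, hsum] at htot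
  simp only [H]
  linarith

/-! ### Joint entropies of lists of atoms -/

lemma Code.rv_eq_iff (C : Code Ω V d) (L : List Atom) (ω ω' : Ω) :
    C.rv L ω = C.rv L ω' ↔ ∀ a ∈ L, C.atomRV a ω = C.atomRV a ω' := by
  simp [Code.rv]

lemma Code.HL_congr (C : Code Ω V d) {L L' : List Atom}
    (h : ∀ ω ω', (∀ a ∈ L, C.atomRV a ω = C.atomRV a ω') ↔
      ∀ a ∈ L', C.atomRV a ω = C.atomRV a ω') : C.HL L = C.HL L' :=
  H_congr _ fun ω ω' => by rw [C.rv_eq_iff, C.rv_eq_iff, h]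

lemma Code.HL_eq_of_mem_iff (C : Code Ω V d) {L L' : List Atom}
    (h : ∀ a, a ∈ L ↔ a ∈ L') : C.HL L = C.HL L' :=
  C.HL_congr fun ω ω' => by simp only [h]

lemma Code.HL_submodular (C : Code Ω V d) (A B D : List Atom) :
    C.HL (A ++ (B ++ D)) + C.HL D ≤ C.HL (A ++ D) + C.HL (B ++ D) := by
  have happ : ∀ L L' : List Atom, C.HL (L ++ L') = H C.p fun ω => (C.rv L ω, C.rv L' ω) :=
    fun L L' => H_congr _ fun ω ω' => by
      simp only [Prod.mk.injEq, C.rv_eq_iff, List.forall_mem_append]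
  have happ₃ : C.HL (A ++ (B ++ D)) = H C.p fun ω => (C.rv A ω, C.rv B ω, C.rv D ω) :=
    H_congr _ fun ω ω' => by
      simp only [Prod.mk.injEq, C.rv_eq_iff, List.forall_mem_append]
  rw [happ₃, happ A D, happ B D]
  exact H_submodular C.p_nonneg C.p_sum _ _ _

/-- Conditioning on more data reduces entropy. -/
lemma Code.HL_append_sub_le (C : Code Ω V d) (A : List Atom) {D E : List Atom}
    (h : ∀ ω ω', (∀ a ∈ E, C.atomRV a ω = C.atomRV a ω') →
      ∀ a ∈ D, C.atomRV a ω = C.atomRV a ω') :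
    C.HL (A ++ E) - C.HL E ≤ C.HL (A ++ D) - C.HL D := by
  have hsub := C.HL_submodular A E D
  have h₁ : C.HL (A ++ (E ++ D)) = C.HL (A ++ E) := C.HL_congr fun ω ω' => by
    simp only [List.forall_mem_append]
    exact ⟨fun H => ⟨H.1, H.2.1⟩, fun H => ⟨H.1, H.2, h ω ω' H.2⟩⟩
  have h₂ : C.HL (E ++ D) = C.HL E := C.HL_congr fun ω ω' => by
    simp only [List.forall_mem_append]
    exact ⟨fun H => H.1, fun H => ⟨H, h ω ω' H⟩⟩
  linarith

/-! ### Membership in the lists of atoms -/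

lemma mem_icc {a b x : ℕ} : x ∈ icc a b ↔ a ≤ x ∧ x ≤ b := by
  simp only [icc, List.mem_range'_1]
  omega

lemma mem_Sto {B : List ℕ} {k : ℕ} {a : Atom} : a ∈ Sto B k ↔ ∃ l ∈ B, a = Atom.S l k := by
  simp [Sto, eq_comm]

lemma mem_U {t s : ℕ} {a : Atom} : a ∈ U d t s ↔
    (∃ k, (1 ≤ k ∧ k ≤ t) ∧ a = Atom.W k) ∨
      ∃ k l, (t + 1 ≤ k ∧ k ≤ s) ∧ (k + 1 ≤ l ∧ l ≤ d + 1) ∧ a = Atom.S l k := by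
  simp [U, Ws, SbarToL, SbarTo, Sto, mem_icc, eq_comm, and_assoc]

lemma mem_Mup {m : ℕ} {a : Atom} : a ∈ Mup m ↔ ∃ k, (1 ≤ k ∧ k ≤ m) ∧ a = Atom.M k := by
  simp [Mup, MsL, mem_icc, eq_comm]

lemma map_perm_Mup (π : Equiv.Perm ℕ) (m : ℕ) : (Mup m).map (Atom.perm π) = Mup m := by
  simp [Mup, MsL, Function.comp_def, Atom.perm]

lemma HL_U_succ (C : Code Ω V d) {t s : ℕ} (hts : t ≤ s) (L : List Atom) :
    C.HL (U d t (s + 1) ++ L) = C.HL (SbarTo d (s + 1) ++ (U d t s ++ L)) := by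
  refine C.HL_eq_of_mem_iff fun a => ?_
  simp only [List.mem_append, mem_U, SbarTo, mem_Sto, mem_icc]
  constructor
  · rintro ((h | ⟨k, l, hk, hl, rfl⟩) | h)
    · exact Or.inr (Or.inl (Or.inl h))
    · rcases hk.2.eq_or_lt with rfl | hlt
      · exact Or.inl ⟨l, hl, rfl⟩
      · exact Or.inr (Or.inl (Or.inr ⟨k, l, by omega, hl, rfl⟩))
    · exact Or.inr (Or.inr h)
  · rintro (⟨l, hl, rfl⟩ | (h | ⟨k, l, hk, hl, rfl⟩) | h)
    · exact Or.inl (Or.inr ⟨s + 1, l, by omega, hl, rfl⟩)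
    · exact Or.inl (Or.inl h)
    · exact Or.inl (Or.inr ⟨k, l, by omega, hl, rfl⟩)
    · exact Or.inr h

/-! ### Consequences of node regeneration and symmetry -/

lemma Code.S_eq_of_W_eq (C : Code Ω V d) {l k : ℕ} (hl : l ∈ Finset.Icc 1 (d + 1))
    (hk : k ∈ Finset.Icc 1 (d + 1)) (hlk : l ≠ k) {ω ω' : Ω} (h : C.W l ω = C.W l ω') :
    C.S l k ω = C.S l k ω' := by
  obtain ⟨f, hf⟩ := C.S_func l hl k hk hlk
  rw [hf, hf, h]

/-- `U^{(t,s)}` determines the contents of the nodes `1, …, s`. -/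
lemma Code.NodeRegen.W_eq_of_U {C : Code Ω V d} (hregen : C.NodeRegen) {t s : ℕ}
    (hs : s ≤ d + 1) {ω ω' : Ω} (h : ∀ a ∈ U d t s, C.atomRV a ω = C.atomRV a ω')
    (k : ℕ) (hk₁ : 1 ≤ k) (hks : k ≤ s) : C.W k ω = C.W k ω' := by
  induction k using Nat.strong_induction_on with
  | _ k ih =>
    by_cases hkt : k ≤ t
    · exact h (Atom.W k) (mem_U.2 (Or.inl ⟨k, ⟨hk₁, hkt⟩, rfl⟩))
    have hk : k ∈ Finset.Icc 1 (d + 1) := Finset.mem_Icc.2 ⟨hk₁, by omega⟩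
    obtain ⟨f, hf⟩ := hregen k hk
    rw [hf, hf]
    congr 1
    rw [C.rv_eq_iff]
    intro a ha
    simp only [StoFull, mem_Sto, List.mem_filter, mem_icc, decide_eq_true_eq] at ha
    obtain ⟨l, ⟨hl, hlk⟩, rfl⟩ := ha
    rcases lt_or_gt_of_ne hlk with hlt | hgt
    · exact C.S_eq_of_W_eq (Finset.mem_Icc.2 hl) hk hlk (ih l hlt hl.1 (by omega))
    · exact h _ (mem_U.2 (Or.inr ⟨k, l, by omega, by omega, rfl⟩))

/-- For a symmetrical code, adding data downloaded by node `s + 1` one source at a time to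
`U^{(t,s)}` has decreasing entropy increments. -/
lemma Code.Symmetrical.HL_Sto_concave {C : Code Ω V d} (hsym : C.Symmetrical) {t s r m : ℕ}
    (hts : t ≤ s) (hr : s + 1 + (r + 2) ≤ d + 1) :
    C.HL (Sto (icc (s + 2) (s + 1 + (r + 2))) (s + 1) ++ (U d t s ++ Mup m))
      + C.HL (Sto (icc (s + 2) (s + 1 + r)) (s + 1) ++ (U d t s ++ Mup m))
      ≤ 2 * C.HL (Sto (icc (s + 2) (s + 1 + (r + 1))) (s + 1) ++ (U d t s ++ Mup m)) := by
  set D := Sto (icc (s + 2) (s + 1 + r)) (s + 1) ++ (U d t s ++ Mup m) with hD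
  have hsub := C.HL_submodular [Atom.S (s + r + 2) (s + 1)] [Atom.S (s + r + 3) (s + 1)] D
  have h₂ : C.HL (Sto (icc (s + 2) (s + 1 + (r + 2))) (s + 1) ++ (U d t s ++ Mup m))
      = C.HL ([Atom.S (s + r + 2) (s + 1)] ++ ([Atom.S (s + r + 3) (s + 1)] ++ D)) := by
    refine C.HL_eq_of_mem_iff fun a => ?_
    simp only [hD, List.mem_append, mem_Sto, mem_icc, List.mem_singleton]
    constructor
    · rintro (⟨l, hl, rfl⟩ | h)
      · by_cases h₁ : l = s + r + 2
        · simp [h₁]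
        by_cases h₂ : l = s + r + 3
        · simp [h₂]
        exact Or.inr (Or.inr (Or.inl ⟨l, by omega, rfl⟩))
      · exact Or.inr (Or.inr (Or.inr h))
    · rintro (rfl | rfl | ⟨l, hl, rfl⟩ | h)
      · exact Or.inl ⟨_, by omega, rfl⟩
      · exact Or.inl ⟨_, by omega, rfl⟩
      · exact Or.inl ⟨l, by omega, rfl⟩
      · exact Or.inr h
  have h₁ : C.HL (Sto (icc (s + 2) (s + 1 + (r + 1))) (s + 1) ++ (U d t s ++ Mup m))
      = C.HL ([Atom.S (s + r + 2) (s + 1)] ++ D) := by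
    refine C.HL_eq_of_mem_iff fun a => ?_
    simp only [hD, List.mem_append, mem_Sto, mem_icc, List.mem_singleton]
    constructor
    · rintro (⟨l, hl, rfl⟩ | h)
      · by_cases h₁ : l = s + r + 2
        · simp [h₁]
        exact Or.inr (Or.inl ⟨l, by omega, rfl⟩)
      · exact Or.inr (Or.inr h)
    · rintro (rfl | ⟨l, hl, rfl⟩ | h)
      · exact Or.inl ⟨_, by omega, rfl⟩
      · exact Or.inl ⟨l, by omega, rfl⟩
      · exact Or.inr h
  set π := Equiv.swap (s + r + 2) (s + r + 3) with hπ
  have hlow : ∀ k, k ≤ s + r + 1 → π k = k := fun k hk =>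
    Equiv.swap_apply_of_ne_of_ne (by omega) (by omega)
  have hrange : ∀ k l, k ≤ s → (k + 1 ≤ l ∧ l ≤ d + 1) → k + 1 ≤ π l ∧ π l ≤ d + 1 := by
    intro k l hk hl
    simp only [hπ, Equiv.swap_apply_def]
    split_ifs <;> omega
  have hswap : C.HL ([Atom.S (s + r + 3) (s + 1)] ++ D)
      = C.HL ([Atom.S (s + r + 2) (s + 1)] ++ D) := by
    rw [← hsym π (fun l hl => ?_) ([Atom.S (s + r + 2) (s + 1)] ++ D)]
    · refine C.HL_eq_of_mem_iff fun a => ?_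
      have hfix : ∀ l ∈ icc (s + 2) (s + 1 + r), π l = l := fun l hl =>
        hlow l (by have := mem_icc.1 hl; omega)
      have hSto : (Sto (icc (s + 2) (s + 1 + r)) (s + 1)).map (Atom.perm π)
          = Sto (icc (s + 2) (s + 1 + r)) (s + 1) := by
        simp only [Sto, List.map_map]
        refine List.map_congr_left fun l hl => ?_
        simp [Atom.perm, hfix l hl, hlow (s + 1) (by omega)]
      have hU : ∀ a, a ∈ (U d t s).map (Atom.perm π) ↔ a ∈ U d t s := by
        intro a
        simp only [List.mem_map, mem_U]
        constructor
        · rintro ⟨b, ⟨k, hk, rfl⟩ | ⟨k, l, hk, hl, rfl⟩, rfl⟩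
          · exact Or.inl ⟨k, hk, by rw [Atom.perm, hlow k (by omega)]⟩
          · exact Or.inr ⟨k, π l, hk, hrange k l hk.2 hl, by rw [Atom.perm, hlow k (by omega)]⟩
        · rintro (⟨k, hk, rfl⟩ | ⟨k, l, hk, hl, rfl⟩)
          · exact ⟨_, Or.inl ⟨k, hk, rfl⟩, by rw [Atom.perm, hlow k (by omega)]⟩
          · refine ⟨_, Or.inr ⟨k, π l, hk, hrange k l hk.2 hl, rfl⟩, ?_⟩
            rw [Atom.perm, hlow k (by omega), hπ, Equiv.swap_apply_self]
      have hpt : Atom.perm π (Atom.S (s + r + 2) (s + 1)) = Atom.S (s + r + 3) (s + 1) := by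
        rw [Atom.perm, hlow (s + 1) (by omega), hπ, Equiv.swap_apply_left]
      simp only [hD, List.map_append, List.mem_append, hSto, hU, map_perm_Mup, List.map_cons,
        List.map_nil, hpt]
    · have := hrange 0 l (Nat.zero_le _) (by simpa using hl)
      simpa using this
  linarith

/-- Averages of a concave sequence over final segments are at most its overall average. -/
lemma mul_sub_le_mul_sub_of_concave {h : ℕ → ℝ} {b c : ℕ} (hc : 0 < c)
    (hconc : ∀ r, r + 2 ≤ b + c → h (r + 2) + h r ≤ 2 * h (r + 1)) :
    ((b + c : ℕ) : ℝ) * (h (b + c) - h b) ≤ (c : ℝ) * (h (b + c) - h 0) := by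
  have hanti : ∀ b' e, b' + e < b + c →
      h (b' + e + 1) - h (b' + e) ≤ h (b' + 1) - h b' := by
    intro b' e
    induction e with
    | zero => intro _; exact le_rfl
    | succ e ih =>
      intro he
      have h₁ := ih (by omega)
      have h₂ := hconc (b' + e) (by omega)
      rw [← add_assoc]
      have : b' + e + 1 + 1 = b' + e + 2 := rfl
      rw [this]
      linarith
  have hinit : ∀ b', b' < b + c → (b' : ℝ) * (h (b' + 1) - h b') ≤ h b' - h 0 := by
    intro b'
    induction b' with
    | zero => intro _; simp
    | succ b' ih =>
      intro hb
      have h₁ := ih (by omega)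
      have h₂ := hanti b' 1 hb
      have h₃ := mul_le_mul_of_nonneg_left h₂ (Nat.cast_nonneg (α := ℝ) (b' + 1))
      push_cast at h₃ ⊢
      linarith
  have hfinal : ∀ e, e ≤ c → h (b + e) - h b ≤ (e : ℝ) * (h (b + 1) - h b) := by
    intro e
    induction e with
    | zero => intro _; simp
    | succ e ih =>
      intro he
      have h₁ := ih (by omega)
      have h₂ := hanti b e (by omega)
      push_cast
      rw [← add_assoc]
      linarith
  have h₁ := mul_le_mul_of_nonneg_left (hinit b (by omega)) (Nat.cast_nonneg (α := ℝ) c)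
  have h₂ := mul_le_mul_of_nonneg_left (hfinal c le_rfl) (Nat.cast_nonneg (α := ℝ) b)
  push_cast
  linarith

/-- A permutation sending `s + 1` to `m + 1`, the block `[t' + 1 : s]` into `[t + 1 : m]` and the
block `[s + 2 : m + 1]` into `[1 : m]`, and fixing all other indices. -/
lemma exists_perm_shift {t t' s m : ℕ} (ht : t' ≤ t) (hs : t' ≤ s) (hm : s + t ≤ m + t') :
    ∃ π : Equiv.Perm ℕ, (∀ k, k ≤ t' → π k = k) ∧
      (∀ k, t' + 1 ≤ k → k ≤ s → t + 1 ≤ π k ∧ π k ≤ m) ∧ π (s + 1) = m + 1 ∧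
      (∀ k, s + 2 ≤ k → k ≤ m + 1 → 1 ≤ π k ∧ π k ≤ m) ∧ ∀ k, m + 2 ≤ k → π k = k := by
  obtain ⟨f, hf⟩ : ∃ f : ℕ → ℕ, ∀ k, f k = if k ≤ t' then k else if k ≤ s then k + t - t'
      else if k = s + 1 then m + 1 else if k ≤ s + 1 + (t - t') then k + t' - (s + 1)
      else if k ≤ m + 1 then k - 1 else k := ⟨_, fun _ => rfl⟩
  obtain ⟨g, hg⟩ : ∃ g : ℕ → ℕ, ∀ k, g k = if k ≤ t' then k else if k ≤ t then k + (s + 1) - t'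
      else if k ≤ s + t - t' then k + t' - t else if k ≤ m then k + 1
      else if k = m + 1 then s + 1 else k := ⟨_, fun _ => rfl⟩
  refine ⟨⟨f, g, fun k => ?_, fun k => ?_⟩, fun k hk => ?_, fun k hk hk' => ?_, ?_,
    fun k hk hk' => ?_, fun k hk => ?_⟩
  · have h₁ := hf k
    have h₂ := hg (f k)
    split_ifs at h₁ <;> split_ifs at h₂ <;> omega
  · have h₁ := hg k
    have h₂ := hf (g k)
    split_ifs at h₁ <;> split_ifs at h₂ <;> omega
  all_goals
    rw [Equiv.coe_fn_mk, hf]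
    split_ifs <;> omega

/-- The last increments of the entropy of the data downloaded by node `s + 1` given `U^{(t',s)}`
dominate the entropy of `S̄_{→m+1}` given `U^{(t,m)}`. -/
lemma Code.HL_SbarTo_sub_le {C : Code Ω V d} (hsym : C.Symmetrical) (hregen : C.NodeRegen)
    {t t' s m : ℕ} (ht : t' ≤ t) (hs : t' ≤ s) (hst : s + t ≤ m + t') (hm : m ≤ d) (q : ℕ) :
    C.HL (SbarTo d (m + 1) ++ (U d t m ++ Mup q)) - C.HL (U d t m ++ Mup q)
      ≤ C.HL (Sto (icc (s + 2) (d + 1)) (s + 1) ++ (U d t' s ++ Mup q))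
        - C.HL (Sto (icc (s + 2) (m + 1)) (s + 1) ++ (U d t' s ++ Mup q)) := by
  obtain ⟨π, hπ₁, hπ₂, hπ₃, hπ₄, hπ₅⟩ := exists_perm_shift ht hs hst
  have hπ : ∀ k ∈ Finset.Icc 1 (d + 1), π k ∈ Finset.Icc 1 (d + 1) := by
    intro k hk
    rw [Finset.mem_Icc] at hk ⊢
    rcases le_or_gt k t' with h | h
    · rwa [hπ₁ k h]
    rcases le_or_gt k s with h' | h'
    · have := hπ₂ k h h'
      omega
    rcases eq_or_ne k (s + 1) with rfl | hne
    · omega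
    rcases le_or_gt k (m + 1) with h'' | h''
    · have := hπ₄ k (by omega) h''
      omega
    · rwa [hπ₅ k h'']
  set D := Sto (icc (s + 2) (m + 1)) (s + 1) ++ (U d t' s ++ Mup q) with hD
  have hsplit : C.HL (Sto (icc (s + 2) (d + 1)) (s + 1) ++ (U d t' s ++ Mup q))
      = C.HL (Sto (icc (m + 2) (d + 1)) (s + 1) ++ D) := by
    refine C.HL_eq_of_mem_iff fun a => ?_
    simp only [hD, List.mem_append (t := _ ++ (_ ++ _)), List.mem_append (t := U d t' s ++ Mup q),
      mem_Sto, mem_icc]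
    constructor
    · rintro (⟨l, hl, rfl⟩ | h)
      · rcases le_or_gt l (m + 1) with h | h
        · exact Or.inr (Or.inl ⟨l, by omega, rfl⟩)
        · exact Or.inl ⟨l, by omega, rfl⟩
      · exact Or.inr (Or.inr h)
    · rintro (⟨l, hl, rfl⟩ | ⟨l, hl, rfl⟩ | h)
      · exact Or.inl ⟨l, by omega, rfl⟩
      · exact Or.inl ⟨l, by omega, rfl⟩
      · exact Or.inr h
  have hmap : (Sto (icc (m + 2) (d + 1)) (s + 1)).map (Atom.perm π) = SbarTo d (m + 1) := by
    simp only [SbarTo, Sto, List.map_map]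
    refine List.map_congr_left fun l hl => ?_
    simp [Atom.perm, hπ₃, hπ₅ l (mem_icc.1 hl).1]
  rw [hsplit, ← hsym π hπ (_ ++ D), ← hsym π hπ D, List.map_append, hmap]
  refine C.HL_append_sub_le _ fun ω ω' h a ha => ?_
  have hU : ∀ a ∈ U d t m, C.atomRV a ω = C.atomRV a ω' :=
    fun a ha => h a (List.mem_append_left _ ha)
  have hW := hregen.W_eq_of_U (by omega) hU
  simp only [hD, List.map_append, map_perm_Mup, List.mem_append] at ha
  rcases ha with ha | ha | ha
  · simp only [List.mem_map, mem_Sto, mem_icc] at ha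
    obtain ⟨_, ⟨l, hl, rfl⟩, rfl⟩ := ha
    have hl' := hπ₄ l hl.1 hl.2
    rw [Atom.perm, hπ₃]
    exact C.S_eq_of_W_eq (Finset.mem_Icc.2 (by omega)) (Finset.mem_Icc.2 (by omega)) (by omega)
      (hW _ hl'.1 hl'.2)
  · simp only [List.mem_map, mem_U] at ha
    obtain ⟨_, ⟨k, hk, rfl⟩ | ⟨k, l, hk, hl, rfl⟩, rfl⟩ := ha
    · rw [Atom.perm, hπ₁ k hk.2]
      exact hW k hk.1 (by omega)
    · have hk' := hπ₂ k hk.1 hk.2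
      have hl' := Finset.mem_Icc.1 (hπ l (Finset.mem_Icc.2 (by omega)))
      rw [Atom.perm]
      rcases le_or_gt (π l) m with hlm | hlm
      · exact C.S_eq_of_W_eq (Finset.mem_Icc.2 hl') (Finset.mem_Icc.2 (by omega))
          (π.injective.ne (by omega)) (hW _ hl'.1 hlm)
      · exact hU _ (mem_U.2 (Or.inr ⟨π k, π l, hk', by omega, rfl⟩))
  · exact h a (List.mem_append_right _ ha)

theorem statement6 {Ω V : Type} [Fintype Ω] {d : ℕ} (hd : 2 ≤ d)
    (C : Code Ω V d) (hsym : C.Symmetrical) (hregen : C.NodeRegen)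
    {m i i' j : ℕ} (hm : m ∈ Finset.Icc 1 (d - 1)) (hi : i ∈ Finset.Icc 0 (m - 1))
    (hi' : i' ∈ Finset.Icc 0 i) (hj : j ∈ Finset.Icc (i' + 1) (m - i + i' + 1)) :
    ((d : ℝ) + 1 - (j : ℝ)) / ((d : ℝ) - (m : ℝ)) * C.CH (U d i m) (Mup m)
        + C.CH (U d i' j) (Mup m)
      ≥ ((d : ℝ) + 1 - (j : ℝ)) / ((d : ℝ) - (m : ℝ)) * C.CH (U d i (m + 1)) (Mup m)
        + C.CH (U d i' (j - 1)) (Mup m) := by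
  simp only [Finset.mem_Icc] at hm hi hi' hj
  obtain ⟨s, rfl⟩ : ∃ s, j = s + 1 := ⟨j - 1, by omega⟩
  obtain ⟨b, rfl⟩ : ∃ b, m = s + b := ⟨m - s, by omega⟩
  obtain ⟨c, rfl⟩ : ∃ c, d = s + b + c := ⟨d - (s + b), by omega⟩
  have hc : 0 < c := by omega
  set h : ℕ → ℝ := fun r => C.HL (Sto (icc (s + 2) (s + 1 + r)) (s + 1) ++
    (U (s + b + c) i' s ++ Mup (s + b))) with hh
  have hconc := mul_sub_le_mul_sub_of_concave (h := h) (b := b) hc fun r hr =>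
    hsym.HL_Sto_concave (by omega) (by omega)
  have hshift := C.HL_SbarTo_sub_le hsym hregen (t := i) (t' := i') (s := s) (m := s + b)
    hi'.2 (by omega) (by omega) (by omega) (s + b)
  have h₀ : h 0 = C.HL (U (s + b + c) i' s ++ Mup (s + b)) := by
    simp [hh, icc, Sto]
  have hbc : h (b + c) = C.HL (U (s + b + c) i' (s + 1) ++ Mup (s + b)) := by
    rw [HL_U_succ C (by omega)]
    have : s + 1 + (b + c) = s + b + c + 1 := by omega
    simp only [hh, SbarTo, this]
  have hlast : C.HL (SbarTo (s + b + c) (s + b + 1) ++ (U (s + b + c) i (s + b) ++ Mup (s + b)))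
      - C.HL (U (s + b + c) i (s + b) ++ Mup (s + b)) ≤ h (b + c) - h b := by
    have h₁ : s + 1 + (b + c) = s + b + c + 1 := by omega
    have h₂ : s + 1 + b = s + b + 1 := by omega
    simpa only [hh, h₁, h₂] using hshift
  rw [← HL_U_succ C (by omega)] at hlast
  simp only [Code.CH, Nat.add_sub_cancel]
  rw [← hbc, ← h₀]
  have hc' : (0 : ℝ) < c := by exact_mod_cast hc
  have hcoef : (((s + b + c : ℕ) : ℝ) + 1 - ((s + 1 : ℕ) : ℝ)) /
      (((s + b + c : ℕ) : ℝ) - ((s + b : ℕ) : ℝ)) = ((b + c : ℕ) : ℝ) / c := by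
    push_cast
    congr 1 <;> ring
  rw [hcoef]
  have h₁ := mul_le_mul_of_nonneg_left hlast
    (div_nonneg (Nat.cast_nonneg (α := ℝ) (b + c)) hc'.le)
  have h₂ : ((b + c : ℕ) : ℝ) / c * (h (b + c) - h b) ≤ h (b + c) - h 0 := by
    rw [div_mul_eq_mul_div, div_le_iff₀ hc']
    linarith
  linarith

end

end MDCSR
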